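/- Let ν be a probability measure on ℝ with bounded continuous density λ positive on the interior of its support, and let ν_α be the translate of ν by α (density λ_α(x) = λ(x − α)). For an increasing (monotone) Borel set A ⊆ ℝⁿ, the map α ↦ ν_α^{⊗n}(A) is differentiable and its derivative equals the sum over i of the geometric influences I_i^G(A) computed under the measure ν_α^{⊗n}. -/

import Mathlib

open MeasureTheory ProbabilityTheory Filter Set Real Pointwise

/-- Lower Minkowski content of a set `A ⊆ ℝ` w.r.t. a measure `ν`. -/
noncomputable def mink (ν : Measure ℝ) (A : Set ℝ) : ℝ :=
  liminf (fun r : ℝ => ((ν (A + Icc (-r) r)).toReal - (ν A).toReal) / r)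
    (nhdsWithin 0 (Ioi 0))

/-- The fiber of `A` along coordinate `i` through `x`. -/
def fiber {n : ℕ} (A : Set (Fin n → ℝ)) (i : Fin n) (x : Fin n → ℝ) : Set ℝ :=
  {y | Function.update x i y ∈ A}

/-- Geometric influence of coordinate `i` on `A` w.r.t. the product measure `ν^⊗n`. -/
noncomputable def geomInfl (n : ℕ) (ν : Measure ℝ) (A : Set (Fin n → ℝ)) (i : Fin n) : ℝ :=
  ∫ x, mink ν (fiber A i x) ∂(Measure.pi fun _ : Fin n => ν)

/-- h-influence of coordinate `i` on `A`. -/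
noncomputable def hInfl (n : ℕ) (ν : Measure ℝ) (h : ℝ → ℝ) (A : Set (Fin n → ℝ))
    (i : Fin n) : ℝ :=
  ∫ x, h ((ν (fiber A i x)).toReal) ∂(Measure.pi fun _ : Fin n => ν)

/-- A finite product of measures with integrable densities has the product density. -/
theorem pi_withDensity_ofReal {ι : Type*} [Fintype ι] {X : ι → Type*}
    [∀ i, MeasurableSpace (X i)] (μ : ∀ i, Measure (X i)) [∀ i, SigmaFinite (μ i)]
    (f : ∀ i, X i → ℝ) (hf : ∀ i, Integrable (f i) (μ i)) (hnn : ∀ i x, 0 ≤ f i x) :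
    Measure.pi (fun i => (μ i).withDensity fun x => ENNReal.ofReal (f i x)) =
      (Measure.pi μ).withDensity fun x => ENNReal.ofReal (∏ i, f i (x i)) := by
  have hfin (i) : IsFiniteMeasure ((μ i).withDensity fun x => ENNReal.ofReal (f i x)) :=
    isFiniteMeasure_withDensity_ofReal (hf i).2
  refine Measure.pi_eq fun s hs => ?_
  rw [withDensity_apply _ (MeasurableSet.univ_pi hs), Measure.restrict_pi_pi,
    ← ofReal_integral_eq_lintegral_ofReal
      (Integrable.fintype_prod_dep fun i => (hf i).restrict)
      (ae_of_all _ fun x => Finset.prod_nonneg fun i _ => hnn i (x i)),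
    integral_fintype_prod_eq_prod,
    ENNReal.ofReal_prod_of_nonneg fun i _ => integral_nonneg (hnn i)]
  refine Finset.prod_congr rfl fun i _ => ?_
  rw [withDensity_apply _ (hs i),
    ofReal_integral_eq_lintegral_ofReal (hf i).restrict (ae_of_all _ (hnn i))]

/-- Resampling one coordinate of a product measure changes only the corresponding factor. -/
theorem map_update_prod_pi {ι : Type*} [Fintype ι] [DecidableEq ι] {X : Type*}
    [MeasurableSpace X] (μ : ι → Measure X) [∀ i, IsProbabilityMeasure (μ i)] (i : ι)
    (ν : Measure X) [IsProbabilityMeasure ν] :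
    ((Measure.pi μ).prod ν).map (fun p => Function.update p.1 i p.2) =
      Measure.pi (Function.update μ i ν) := by
  have hprob (j) : IsProbabilityMeasure (Function.update μ i ν j) := by
    rcases eq_or_ne j i with rfl | h
    · simpa
    · simpa [h] using inferInstanceAs (IsProbabilityMeasure (μ j))
  symm
  refine Measure.pi_eq fun s hs => ?_
  rw [Measure.map_apply (by fun_prop) (MeasurableSet.univ_pi hs)]
  have hpre : (fun p : (ι → X) × X => Function.update p.1 i p.2) ⁻¹' univ.pi s =
      univ.pi (Function.update s i univ) ×ˢ s i := by
    ext p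
    simp only [mem_preimage, Set.mem_pi, mem_univ, true_implies, mem_prod]
    constructor
    · refine fun h => ⟨fun j => ?_, by simpa using h i⟩
      rcases eq_or_ne j i with rfl | hj
      · simp
      · simpa [hj] using h j
    · rintro ⟨h, hi⟩ j
      rcases eq_or_ne j i with rfl | hj
      · simpa
      · simpa [hj] using h j
  rw [hpre, Measure.prod_prod, Measure.pi_pi,
    ← Finset.mul_prod_erase _ _ (Finset.mem_univ i),
    ← Finset.mul_prod_erase _ _ (Finset.mem_univ i)]
  simp only [Function.update_self, measure_univ, one_mul]
  rw [mul_comm]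
  congr 1
  refine Finset.prod_congr rfl fun j hj => ?_
  simp [Finset.ne_of_mem_erase hj]

/-- **Scheffé's lemma**. -/
theorem tendsto_integral_abs_sub_of_tendsto_integral {ι X : Type*} [MeasurableSpace X]
    {μ : Measure X} {l : Filter ι} [l.IsCountablyGenerated] {p : ι → X → ℝ} {p₀ : X → ℝ}
    (hp : ∀ a, Integrable (p a) μ) (hnn : ∀ a x, 0 ≤ p a x) (hp₀ : Integrable p₀ μ)
    (hint : Tendsto (fun a => ∫ x, p a x ∂μ) l (nhds (∫ x, p₀ x ∂μ)))
    (hlim : ∀ x, Tendsto (fun a => p a x) l (nhds (p₀ x))) :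
    Tendsto (fun a => ∫ x, |p a x - p₀ x| ∂μ) l (nhds 0) := by
  have hpos : Tendsto (fun a => ∫ x, max (p₀ x - p a x) 0 ∂μ) l (nhds (∫ _, (0 : ℝ) ∂μ)) := by
    refine tendsto_integral_filter_of_dominated_convergence (fun x => |p₀ x|)
      (Eventually.of_forall fun a => (hp₀.sub (hp a)).pos_part.1)
      (Eventually.of_forall fun a => ae_of_all _ fun x => ?_) hp₀.abs (ae_of_all _ fun x => ?_)
    · rw [Real.norm_eq_abs, abs_of_nonneg (le_max_right _ _)]
      exact max_le (by linarith [hnn a x, le_abs_self (p₀ x)]) (abs_nonneg _)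
    · simpa using ((hlim x).const_sub (p₀ x)).max (tendsto_const_nhds (x := (0 : ℝ)))
  have heq (a) : ∫ x, |p a x - p₀ x| ∂μ =
      (∫ x, p a x ∂μ - ∫ x, p₀ x ∂μ) + 2 * ∫ x, max (p₀ x - p a x) 0 ∂μ := by
    have hsub : Integrable (fun x => p a x - p₀ x) μ := (hp a).sub hp₀
    have hmax : Integrable (fun x => 2 * max (p₀ x - p a x) 0) μ :=
      (hp₀.sub (hp a)).pos_part.const_mul 2
    rw [← integral_const_mul, ← integral_sub (hp a) hp₀, ← integral_add hsub hmax]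
    refine integral_congr_ae (ae_of_all _ fun x => ?_)
    rcases le_total (p a x) (p₀ x) with h | h
    · simp only [abs_of_nonpos (sub_nonpos.2 h), max_eq_left (sub_nonneg.2 h)]
      ring
    · simp [abs_of_nonneg (sub_nonneg.2 h), max_eq_right (sub_nonpos.2 h)]
  simp only [heq]
  simpa using (hint.sub_const (∫ x, p₀ x ∂μ)).add (hpos.const_mul 2)

/-- Integrals of uniformly bounded, pointwise convergent functions against converging
densities converge. -/
theorem tendsto_integral_mul_of_scheffe {ι X : Type*} [MeasurableSpace X]
    {μ : Measure X} {l : Filter ι} [l.IsCountablyGenerated] {p q : ι → X → ℝ} {p₀ q₀ : X → ℝ}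
    {M : ℝ} (hp : ∀ a, Integrable (p a) μ) (hnn : ∀ a x, 0 ≤ p a x) (hp₀ : Integrable p₀ μ)
    (hint : Tendsto (fun a => ∫ x, p a x ∂μ) l (nhds (∫ x, p₀ x ∂μ)))
    (hlim : ∀ x, Tendsto (fun a => p a x) l (nhds (p₀ x)))
    (hq : ∀ a, AEStronglyMeasurable (q a) μ) (hM : ∀ a x, |q a x| ≤ M)
    (hqlim : ∀ x, Tendsto (fun a => q a x) l (nhds (q₀ x))) :
    Tendsto (fun a => ∫ x, p a x * q a x ∂μ) l (nhds (∫ x, p₀ x * q₀ x ∂μ)) := by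
  have hmain : Tendsto (fun a => ∫ x, p₀ x * q a x ∂μ) l (nhds (∫ x, p₀ x * q₀ x ∂μ)) := by
    refine tendsto_integral_filter_of_dominated_convergence (fun x => |p₀ x| * M)
      (Eventually.of_forall fun a => hp₀.1.mul (hq a))
      (Eventually.of_forall fun a => ae_of_all _ fun x => ?_) (hp₀.abs.mul_const M)
      (ae_of_all _ fun x => (hqlim x).const_mul _)
    rw [norm_mul]
    exact mul_le_mul_of_nonneg_left (hM a x) (abs_nonneg _)
  have hprod {f : X → ℝ} (hf : Integrable f μ) (a : ι) : Integrable (fun x => f x * q a x) μ :=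
    hf.mul_bdd (hq a) (ae_of_all _ (hM a))
  have herr : Tendsto (fun a => ∫ x, (p a x - p₀ x) * q a x ∂μ) l (nhds 0) := by
    refine squeeze_zero_norm (a := fun a => (∫ x, |p a x - p₀ x| ∂μ) * M) (fun a => ?_) ?_
    · rw [← integral_mul_const]
      refine norm_integral_le_of_norm_le (((hp a).sub hp₀).abs.mul_const M)
        (ae_of_all _ fun x => ?_)
      rw [norm_mul]
      exact mul_le_mul_of_nonneg_left (hM a x) (abs_nonneg _)
    · simpa using (tendsto_integral_abs_sub_of_tendsto_integral hp hnn hp₀ hint hlim).mul_const M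
  have heq (a) : ∫ x, p a x * q a x ∂μ =
      ∫ x, (p a x - p₀ x) * q a x ∂μ + ∫ x, p₀ x * q a x ∂μ := by
    have hsub : Integrable (fun x => p a x - p₀ x) μ := (hp a).sub hp₀
    rw [← integral_add (hprod hsub a) (hprod hp₀ a)]
    exact integral_congr_ae (ae_of_all _ fun x => by ring)
  simp only [heq]
  simpa using herr.add hmain

/-- The translate by `a` of the measure with density `lam` on the real line. -/
noncomputable def translatedMeasure (lam : ℝ → ℝ) (a : ℝ) : Measure ℝ :=
  volume.withDensity fun x => ENNReal.ofReal (lam (x - a))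

theorem translatedMeasure_preimage_add (lam : ℝ → ℝ) (a r : ℝ) (S : Set ℝ) :
    translatedMeasure lam a ((· + r) ⁻¹' S) = translatedMeasure lam (a + r) S := by
  rw [translatedMeasure, translatedMeasure, withDensity_apply', withDensity_apply',
    ← (measurePreserving_add_right volume r).setLIntegral_comp_preimage_emb
      (measurableEmbedding_addRight r) (fun x => ENNReal.ofReal (lam (x - (a + r)))) S]
  simp only [add_sub_add_right_eq_sub]

theorem isProbabilityMeasure_translatedMeasure {lam : ℝ → ℝ} (hnn : ∀ x, 0 ≤ lam x)
    (hint : ∫ x, lam x = 1) (a : ℝ) : IsProbabilityMeasure (translatedMeasure lam a) := by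
  have hlam : Integrable lam := .of_integral_ne_zero (by simp [hint])
  refine ⟨?_⟩
  rw [translatedMeasure, withDensity_apply _ MeasurableSet.univ, Measure.restrict_univ,
    ← ofReal_integral_eq_lintegral_ofReal (hlam.comp_sub_right a) (ae_of_all _ fun x => hnn _),
    integral_sub_right_eq_self (fun x => lam x), hint, ENNReal.ofReal_one]

theorem toReal_translatedMeasure_Ioi {lam : ℝ → ℝ} (hnn : ∀ x, 0 ≤ lam x)
    (hlam : Integrable lam) (a t : ℝ) :
    (translatedMeasure lam a (Ioi t)).toReal = ∫ y in Ioi (t - a), lam y := by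
  rw [translatedMeasure, withDensity_apply _ measurableSet_Ioi,
    ← ofReal_integral_eq_lintegral_ofReal (hlam.comp_sub_right a).restrict
      (ae_of_all _ fun x => hnn _), ENNReal.toReal_ofReal (integral_nonneg fun x => hnn _),
    ← (measurePreserving_sub_right volume a).setIntegral_preimage_emb
      (measurableEmbedding_subRight a) lam (Ioi (t - a))]
  simp

theorem hasDerivAt_integral_Ioi {f : ℝ → ℝ} (hf : Integrable f) (hc : Continuous f) (u : ℝ) :
    HasDerivAt (fun v => ∫ y in Ioi v, f y) (-f u) u := by
  have h (v : ℝ) : ∫ y in Ioi v, f y = (∫ y in Ioi 0, f y) - ∫ y in (0 : ℝ)..v, f y := by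
    rw [← intervalIntegral.integral_Ioi_sub_Ioi' hf.integrableOn hf.integrableOn, sub_sub_cancel]
  rw [funext h]
  exact (hc.integral_hasStrictDerivAt 0 u).hasDerivAt.const_sub _

theorem exists_hasDerivAt_translatedMeasure {lam : ℝ → ℝ} (hc : Continuous lam)
    (hnn : ∀ x, 0 ≤ lam x) (hint : ∫ x, lam x = 1) {M : ℝ} (hM : ∀ x, lam x ≤ M) {S : Set ℝ}
    (hS : IsUpperSet S) (a : ℝ) :
    ∃ d, |d| ≤ M ∧ HasDerivAt (fun b => (translatedMeasure lam b S).toReal) d a := by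
  have hlam : Integrable lam := .of_integral_ne_zero (by simp [hint])
  have := isProbabilityMeasure_translatedMeasure hnn hint
  have hM₀ : 0 ≤ M := (hnn 0).trans (hM 0)
  rcases S.eq_empty_or_nonempty with rfl | hne
  · exact ⟨0, by simpa, by simpa using hasDerivAt_const a (0 : ℝ)⟩
  by_cases huniv : S = univ
  · exact ⟨0, by simpa, by simpa [huniv] using hasDerivAt_const a (1 : ℝ)⟩
  obtain ⟨z, hz⟩ := (ne_univ_iff_exists_notMem S).1 huniv
  have hbdd : BddBelow S := ⟨z, fun s hs => le_of_not_ge fun h => hz (hS h hs)⟩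
  have hIoi : Ioi (sInf S) ⊆ S := fun y hy => by
    obtain ⟨s, hs, hsy⟩ := exists_lt_of_csInf_lt hne hy
    exact hS hsy.le hs
  have hIci : S ⊆ Ici (sInf S) := fun y hy => csInf_le hbdd hy
  have heq (b) : translatedMeasure lam b S = translatedMeasure lam b (Ioi (sInf S)) := by
    refine le_antisymm ?_ (measure_mono hIoi)
    have : NullSingletonClass (translatedMeasure lam b) := by unfold translatedMeasure; infer_instance
    exact (measure_mono hIci).trans_eq (measure_congr Ioi_ae_eq_Ici.symm)
  refine ⟨lam (sInf S - a), by simpa [abs_of_nonneg (hnn _)] using hM _, ?_⟩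
  simp only [heq, toReal_translatedMeasure_Ioi hnn hlam]
  simpa [Function.comp_def] using HasDerivAt.comp a (hasDerivAt_integral_Ioi hlam hc (sInf S - a))
    ((hasDerivAt_id a).const_sub (sInf S))

theorem mink_eq_of_hasDerivAt {lam : ℝ → ℝ} {S : Set ℝ} (hS : IsUpperSet S) {a d : ℝ}
    (h : HasDerivAt (fun b => (translatedMeasure lam b S).toReal) d a) :
    mink (translatedMeasure lam a) S = d := by
  have hadd {r : ℝ} (hr : 0 < r) : S + Icc (-r) r = (· + r) ⁻¹' S := by
    ext y
    constructor
    · rintro ⟨s, hs, u, hu, rfl⟩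
      exact hS (by linarith [hu.1]) hs
    · exact fun hy => ⟨y + r, hy, -r, ⟨le_rfl, by linarith⟩, by ring⟩
  refine Tendsto.liminf_eq ?_
  refine (h.tendsto_slope_zero.mono_left (nhdsWithin_mono _ fun r hr => ne_of_gt hr)).congr' ?_
  filter_upwards [self_mem_nhdsWithin] with r hr
  rw [hadd hr, translatedMeasure_preimage_add, smul_eq_mul, div_eq_inv_mul]

theorem abs_slope_translatedMeasure_le {lam : ℝ → ℝ} (hc : Continuous lam)
    (hnn : ∀ x, 0 ≤ lam x) (hint : ∫ x, lam x = 1) {M : ℝ} (hM : ∀ x, lam x ≤ M) {S : Set ℝ}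
    (hS : IsUpperSet S) (a b : ℝ) :
    |slope (fun c => (translatedMeasure lam c S).toReal) a b| ≤ M := by
  choose d hd hderiv using exists_hasDerivAt_translatedMeasure hc hnn hint hM hS
  rcases eq_or_ne a b with rfl | hab
  · simpa using (hnn 0).trans (hM 0)
  have := convex_univ.norm_image_sub_le_of_norm_hasDerivWithin_le
    (fun x _ => (hderiv x).hasDerivWithinAt) (fun x _ => hd x) (mem_univ a) (mem_univ b)
  rw [slope_def_field, abs_div, div_le_iff₀ (abs_pos.2 (sub_ne_zero.2 hab.symm))]
  exact this

theorem isUpperSet_fiber {n : ℕ} {A : Set (Fin n → ℝ)} (hA : IsUpperSet A) (i : Fin n)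
    (x : Fin n → ℝ) : IsUpperSet (fiber A i x) :=
  fun _ _ h hy => hA (update_le_update_iff.2 ⟨h, fun _ _ => le_rfl⟩) hy

theorem measurable_toReal_fiber {n : ℕ} {A : Set (Fin n → ℝ)} (hA : MeasurableSet A) (i : Fin n)
    (ν : Measure ℝ) [SFinite ν] : Measurable fun x => (ν (fiber A i x)).toReal := by
  have hmeas : MeasurableSet
      ((fun p : (Fin n → ℝ) × ℝ => Function.update p.1 i p.2) ⁻¹' A) :=
    (by fun_prop : Measurable _) hA
  exact (measurable_measure_prodMk_left hmeas).ennreal_toReal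

/-- The measure of a set under a product measure, computed by integrating the measure of the
fibers along one coordinate. -/
theorem toReal_pi_update_apply {n : ℕ} (μ : Fin n → Measure ℝ) [∀ i, IsProbabilityMeasure (μ i)]
    (i : Fin n) (ν : Measure ℝ) [IsProbabilityMeasure ν] {A : Set (Fin n → ℝ)}
    (hA : MeasurableSet A) :
    (Measure.pi (Function.update μ i ν) A).toReal =
      ∫ x, (ν (fiber A i x)).toReal ∂(Measure.pi μ) := by
  have hupd : Measurable fun p : (Fin n → ℝ) × ℝ => Function.update p.1 i p.2 := by fun_prop
  rw [← map_update_prod_pi, Measure.map_apply hupd hA, Measure.prod_apply (hupd hA),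
    ← integral_toReal (measurable_measure_prodMk_left (hupd hA)).aemeasurable
      (ae_of_all _ fun x => measure_lt_top _ _)]
  rfl

theorem tendsto_integral_slope_geomInfl {n : ℕ} {lam : ℝ → ℝ} (hc : Continuous lam)
    (hnn : ∀ x, 0 ≤ lam x) (hint : ∫ x, lam x = 1) {M : ℝ} (hM : ∀ x, lam x ≤ M)
    {A : Set (Fin n → ℝ)} (hA : MeasurableSet A) (hup : IsUpperSet A) (i : Fin n) (α : ℝ)
    {c : ℝ → Fin n → ℝ} (hclim : ∀ j, Tendsto (fun a => c a j) (nhdsWithin α {α}ᶜ) (nhds α)) :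
    Tendsto (fun a => ∫ x, slope (fun b => (translatedMeasure lam b (fiber A i x)).toReal) α a
      ∂(Measure.pi fun j => translatedMeasure lam (c a j))) (nhdsWithin α {α}ᶜ)
      (nhds (geomInfl n (translatedMeasure lam α) A i)) := by
  have hlam : Integrable lam := .of_integral_ne_zero (by simp [hint])
  have hprob := isProbabilityMeasure_translatedMeasure hnn hint
  have hpint (v : Fin n → ℝ) : Integrable fun x : Fin n → ℝ => ∏ j, lam (x j - v j) :=
    Integrable.fintype_prod fun j => hlam.comp_sub_right (v j)
  have hpone (v : Fin n → ℝ) : ∫ x : Fin n → ℝ, ∏ j, lam (x j - v j) = 1 := by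
    rw [integral_fintype_prod_volume_eq_prod (fun j y => lam (y - v j))]
    simp [integral_sub_right_eq_self (fun y => lam y), hint]
  have hpi (v : Fin n → ℝ) (g : (Fin n → ℝ) → ℝ) :
      ∫ x, g x ∂(Measure.pi fun j => translatedMeasure lam (v j)) =
        ∫ x : Fin n → ℝ, (∏ j, lam (x j - v j)) * g x := by
    unfold translatedMeasure
    rw [pi_withDensity_ofReal (fun _ : Fin n => volume) (fun j y => lam (y - v j))
      (fun j => hlam.comp_sub_right (v j)) (fun j y => hnn _),
      integral_withDensity_eq_integral_toReal_smul
        (f := fun x : Fin n → ℝ => ENNReal.ofReal (∏ j, lam (x j - v j))) (by fun_prop)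
        (ae_of_all _ fun _ => ENNReal.ofReal_lt_top)]
    refine integral_congr_ae (ae_of_all _ fun x => ?_)
    simp only [smul_eq_mul, ENNReal.toReal_ofReal (Finset.prod_nonneg fun j _ => hnn (x j - v j))]
  have hmeas (a : ℝ) : Measurable fun x =>
      slope (fun b => (translatedMeasure lam b (fiber A i x)).toReal) α a := by
    simp only [slope_def_field]
    exact ((measurable_toReal_fiber hA i _).sub (measurable_toReal_fiber hA i _)).div_const _
  have hlim (x : Fin n → ℝ) : Tendsto
      (fun a => slope (fun b => (translatedMeasure lam b (fiber A i x)).toReal) α a)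
      (nhdsWithin α {α}ᶜ) (nhds (mink (translatedMeasure lam α) (fiber A i x))) := by
    have hS := isUpperSet_fiber hup i x
    obtain ⟨d, -, hd⟩ := exists_hasDerivAt_translatedMeasure hc hnn hint hM hS α
    rw [mink_eq_of_hasDerivAt hS hd]
    exact hasDerivAt_iff_tendsto_slope.1 hd
  rw [geomInfl, hpi fun _ => α]
  simp only [hpi]
  refine tendsto_integral_mul_of_scheffe (fun a => hpint (c a))
    (fun a x => Finset.prod_nonneg fun j _ => hnn _) (hpint fun _ => α) ?_ (fun x => ?_)
    (fun a => (hmeas a).aestronglyMeasurable)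
    (fun a x => abs_slope_translatedMeasure_le hc hnn hint hM (isUpperSet_fiber hup i x) α a) hlim
  · simp only [hpone]
    exact tendsto_const_nhds
  · exact tendsto_finsetProd _ fun j _ =>
      (hc.tendsto _).comp (tendsto_const_nhds.sub (hclim j))

theorem stmt3 (n : ℕ) (lam : ℝ → ℝ) (hcont : Continuous lam) (hnn : ∀ x, 0 ≤ lam x)
    (hbdd : ∃ M, ∀ x, lam x ≤ M) (hint : ∫ x, lam x = 1)
    (hpos : ∀ x ∈ interior (closure {z | 0 < lam z}), 0 < lam x)
    (A : Set (Fin n → ℝ)) (hA : MeasurableSet A)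
    (hmono : ∀ x ∈ A, ∀ y : Fin n → ℝ, (∀ i, x i ≤ y i) → y ∈ A)
    (α : ℝ) :
    HasDerivAt
      (fun a : ℝ => ((Measure.pi fun _ : Fin n =>
        volume.withDensity fun x => ENNReal.ofReal (lam (x - a))) A).toReal)
      (∑ i, geomInfl n (volume.withDensity fun x => ENNReal.ofReal (lam (x - α))) A i)
      α := by
  obtain ⟨M, hM⟩ := hbdd
  have hup : IsUpperSet A := fun x y hxy hx => hmono x hx y hxy
  have hprob := isProbabilityMeasure_translatedMeasure hnn hint
  change HasDerivAt (fun a => (Measure.pi (fun _ : Fin n => translatedMeasure lam a) A).toReal)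
    (∑ i, geomInfl n (translatedMeasure lam α) A i) α
  let c (k : ℕ) (a : ℝ) (j : Fin n) : ℝ := if j.val < k then a else α
  have hclim (k : ℕ) (j : Fin n) :
      Tendsto (fun a => c k a j) (nhdsWithin α {α}ᶜ) (nhds α) := by
    by_cases hj : j.val < k
    · simp only [c, hj, if_true]
      exact tendsto_id.mono_left nhdsWithin_le_nhds
    · simp [c, hj]
  let G (k : ℕ) (a : ℝ) : ℝ :=
    (Measure.pi (fun j => translatedMeasure lam (c k a j)) A).toReal
  have hupd (i : Fin n) (a b : ℝ) : (fun j => translatedMeasure lam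
      (Function.update (c i a) i b j)) =
      Function.update (fun j => translatedMeasure lam (c i a j)) i (translatedMeasure lam b) := by
    ext1 j
    rcases eq_or_ne j i with rfl | hj
    · simp
    · simp [hj]
  have hc_succ (i : Fin n) (a : ℝ) : c (i + 1) a = Function.update (c i a) i a := by
    ext1 j
    rcases eq_or_ne j i with rfl | hj
    · simp [c]
    · have : j.val < i.val + 1 ↔ j.val < i.val := by
        have := Fin.val_ne_of_ne hj
        omega
      simp [c, hj, this]
  have hc_self (i : Fin n) (a : ℝ) : c i a = Function.update (c i a) i α := by simp [c]
  have hstep (i : Fin n) (a : ℝ) : (a - α)⁻¹ * (G (i + 1) a - G i a) =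
      ∫ x, slope (fun b => (translatedMeasure lam b (fiber A i x)).toReal) α a
        ∂(Measure.pi fun j => translatedMeasure lam (c i a j)) := by
    have hG_succ : G (i + 1) a = ∫ x, (translatedMeasure lam a (fiber A i x)).toReal
        ∂(Measure.pi fun j => translatedMeasure lam (c i a j)) := by
      simp only [G]
      rw [hc_succ, hupd, toReal_pi_update_apply _ _ _ hA]
    have hG : G i a = ∫ x, (translatedMeasure lam α (fiber A i x)).toReal
        ∂(Measure.pi fun j => translatedMeasure lam (c i a j)) := by
      rw [← toReal_pi_update_apply _ _ _ hA, ← hupd, ← hc_self]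
    have hi (b : ℝ) : Integrable (fun x => (translatedMeasure lam b (fiber A i x)).toReal)
        (Measure.pi fun j => translatedMeasure lam (c i a j)) :=
      .of_bound (measurable_toReal_fiber hA i _).aestronglyMeasurable 1
        (ae_of_all _ fun x => (Real.norm_of_nonneg ENNReal.toReal_nonneg).trans_le
          (measureReal_le_one (μ := translatedMeasure lam b) (s := fiber A i x)))
    rw [hG_succ, hG, ← integral_sub (hi a) (hi α), ← integral_const_mul]
    simp only [slope_def_field, div_eq_inv_mul]
  rw [hasDerivAt_iff_tendsto_slope]
  refine (tendsto_finsetSum Finset.univ fun i _ =>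
    tendsto_integral_slope_geomInfl hcont hnn hint hM hA hup i α (hclim i)).congr fun a => ?_
  have hG_last : G n a = (Measure.pi (fun _ : Fin n => translatedMeasure lam a) A).toReal := by
    simp [G, c]
  have hG_zero : G 0 a = (Measure.pi (fun _ : Fin n => translatedMeasure lam α) A).toReal := by
    simp [G, c]
  rw [slope_def_field, ← hG_last, ← hG_zero, ← Finset.sum_range_sub (fun k => G k a),
    Finset.sum_range, div_eq_inv_mul, Finset.mul_sum]
  exact Finset.sum_congr rfl fun i _ => (hstep i a).symm
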